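/- Let E and F be Banach spaces, 1 ≤ p < ∞, m ≥ 2, and let P : E → F be a p-compact m-homogeneous polynomial with associated continuous symmetric m-linear map P̌. For a ∈ E define the (m−1)-homogeneous polynomial P_a(x) = P̌(a, x, …, x). Then P_a is p-compact and κ_p(P_a) ≤ e ‖a‖ κ_p(P). -/

import Mathlib

open scoped ENNReal NNReal Classical
open Filter Metric

noncomputable section

/-- Membership in the closed unit ball of `ℓ_q`, where `q` is the conjugate exponent of `p`
(`q = ∞`, i.e. bounded coefficients, when `p = 1`). -/
def ConjUnitBall (p : ℝ) (α : ℕ → ℂ) : Prop :=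
  if p = 1 then ∀ n, ‖α n‖ ≤ 1
  else (Summable fun n => ‖α n‖ ^ (p / (p - 1))) ∧ (∑' n, ‖α n‖ ^ (p / (p - 1))) ≤ 1

variable {E F : Type*} [NormedAddCommGroup E] [NormedSpace ℂ E]
  [NormedAddCommGroup F] [NormedSpace ℂ F]

/-- The `p`-convex hull `p-co{x_n}` of a sequence `(x_n)`. -/
def pCo (p : ℝ) (x : ℕ → F) : Set F :=
  {y | ∃ α : ℕ → ℂ, ConjUnitBall p α ∧ HasSum (fun n => α n • x n) y}

/-- A set is relatively `p`-compact if it is contained in the `p`-convex hull of a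
`p`-summable sequence. -/
def IsRelPCompact (p : ℝ) (K : Set F) : Prop :=
  ∃ x : ℕ → F, (Summable fun n => ‖x n‖ ^ p) ∧ K ⊆ pCo p x

/-- The measure of `p`-compactness `m_p(K)`. -/
def mP (p : ℝ) (K : Set F) : ℝ :=
  sInf {r : ℝ | ∃ x : ℕ → F, (Summable fun n => ‖x n‖ ^ p) ∧ K ⊆ pCo p x ∧
    r = (∑' n, ‖x n‖ ^ p) ^ (1 / p)}

/-- `m_p(K)` as an element of `[0, ∞]`; it equals `∞` when `K` is not relatively
`p`-compact. -/
def mPE (p : ℝ) (K : Set F) : ℝ≥0∞ :=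
  sInf {r : ℝ≥0∞ | ∃ x : ℕ → F, (Summable fun n => ‖x n‖ ^ p) ∧ K ⊆ pCo p x ∧
    r = ENNReal.ofReal ((∑' n, ‖x n‖ ^ p) ^ (1 / p))}

/-- The `m`-homogeneous polynomial `P_m f(x₀)` in the Taylor series expansion of `f` at `x₀`. -/
def taylorPoly (f : E → F) (x₀ : E) (m : ℕ) (x : E) : F :=
  ((m.factorial : ℂ))⁻¹ • iteratedFDeriv ℂ m f x₀ fun _ => x

/-- `f` is `p`-compact at `x₀` if some neighborhood of `x₀` has relatively `p`-compact
image under `f`. -/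
def PCompactAt (p : ℝ) (f : E → F) (x₀ : E) : Prop :=
  ∃ V ∈ nhds x₀, IsRelPCompact p (f '' V)

/-- The radius of `p`-compact convergence of `f` at `x₀`:
`r_p(f, x₀) = 1 / limsup κ_p(P_mf(x₀))^{1/m}` (with the conventions `1/0 = ∞`, and
`κ_p(P) = ∞` when `P` is not `p`-compact, so that `r_p(f,x₀) = 0` in that case). -/
def pRadius (p : ℝ) (f : E → F) (x₀ : E) : ℝ≥0∞ :=
  (Filter.limsup (fun m : ℕ => (mPE p (taylorPoly f x₀ m '' closedBall 0 1)) ^ (1 / (m : ℝ)))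
    Filter.atTop)⁻¹

/-- The `m`-homogeneous polynomial associated to a continuous `m`-linear map. -/
def polyEval {m : ℕ} (A : ContinuousMultilinearMap ℂ (fun _ : Fin m => E) F) (x : E) : F :=
  A fun _ => x

lemma ConjUnitBall.smul {p : ℝ} (hp : 1 ≤ p) {α : ℕ → ℂ} (hα : ConjUnitBall p α) {c : ℂ}
    (hc : ‖c‖ ≤ 1) : ConjUnitBall p (c • α) := by
  have hle (n : ℕ) : ‖(c • α) n‖ ≤ ‖α n‖ := by
    simpa using mul_le_of_le_one_left (norm_nonneg (α n)) hc
  unfold ConjUnitBall at hα ⊢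
  split_ifs at hα ⊢ with h1
  · exact fun n => (hle n).trans (hα n)
  · have hq : 0 ≤ p / (p - 1) := div_nonneg (by linarith) (by linarith)
    have hpow (n : ℕ) : ‖(c • α) n‖ ^ (p / (p - 1)) ≤ ‖α n‖ ^ (p / (p - 1)) :=
      Real.rpow_le_rpow (norm_nonneg _) (hle n) hq
    have hs : Summable fun n => ‖(c • α) n‖ ^ (p / (p - 1)) :=
      hα.1.of_nonneg_of_le (fun n => by positivity) hpow
    exact ⟨hs, (hs.tsum_le_tsum hpow hα.1).trans hα.2⟩

lemma convex_conjUnitBall {p : ℝ} (hp : 1 ≤ p) : Convex ℝ {α : ℕ → ℂ | ConjUnitBall p α} := by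
  intro α hα β hβ s t hs ht hst
  have hle (n : ℕ) : ‖(s • α + t • β) n‖ ≤ s * ‖α n‖ + t * ‖β n‖ := by
    refine (norm_add_le _ _).trans_eq ?_
    simp [abs_of_nonneg hs, abs_of_nonneg ht]
  simp only [Set.mem_ofPred_eq, ConjUnitBall] at hα hβ ⊢
  split_ifs at hα hβ ⊢ with h1
  · intro n
    nlinarith [hle n, hα n, hβ n]
  · have hp1 : 1 < p := lt_of_le_of_ne hp (Ne.symm h1)
    have hq : 1 ≤ p / (p - 1) := by rw [le_div_iff₀] <;> linarith
    have hpow (n : ℕ) : ‖(s • α + t • β) n‖ ^ (p / (p - 1)) ≤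
        s * ‖α n‖ ^ (p / (p - 1)) + t * ‖β n‖ ^ (p / (p - 1)) :=
      (Real.rpow_le_rpow (norm_nonneg _) (hle n) (by linarith)).trans
        ((convexOn_rpow hq).2 (norm_nonneg (α n)) (norm_nonneg (β n)) hs ht hst)
    have hsum := (hα.1.mul_left s).add (hβ.1.mul_left t)
    have hs' : Summable fun n => ‖(s • α + t • β) n‖ ^ (p / (p - 1)) :=
      hsum.of_nonneg_of_le (fun n => by positivity) hpow
    refine ⟨hs', (hs'.tsum_le_tsum hpow hsum).trans ?_⟩
    rw [(hα.1.mul_left s).tsum_add (hβ.1.mul_left t), tsum_mul_left, tsum_mul_left]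
    nlinarith [hα.2, hβ.2]

lemma convex_pCo {p : ℝ} (hp : 1 ≤ p) (x : ℕ → F) : Convex ℝ (pCo p x) := by
  rintro y ⟨α, hα, hy⟩ z ⟨β, hβ, hz⟩ s t hs ht hst
  refine ⟨s • α + t • β, convex_conjUnitBall hp hα hβ hs ht hst, ?_⟩
  convert (hy.const_smul s).add (hz.const_smul t) using 2 with n
  simp [add_smul, mul_smul]

lemma smul_mem_pCo {p : ℝ} (hp : 1 ≤ p) {x : ℕ → F} {y : F} (hy : y ∈ pCo p x) {c : ℂ}
    (hc : ‖c‖ ≤ 1) : c • y ∈ pCo p x := by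
  obtain ⟨α, hα, hy⟩ := hy
  refine ⟨c • α, hα.smul hp hc, ?_⟩
  convert hy.const_smul c using 2 with n
  simp [mul_smul]

lemma smul_mem_pCo_smul {p : ℝ} {x : ℕ → F} {y : F} (hy : y ∈ pCo p x) (c : ℂ) :
    c • y ∈ pCo p (c • x) := by
  obtain ⟨α, hα, hy⟩ := hy
  refine ⟨α, hα, ?_⟩
  convert hy.const_smul c using 2 with n
  simp [smul_comm c]

lemma norm_smul_rpow {p C : ℝ} (hC : 0 ≤ C) (x : ℕ → F) (n : ℕ) :
    ‖((C : ℂ) • x) n‖ ^ p = C ^ p * ‖x n‖ ^ p := by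
  rw [Pi.smul_apply, norm_smul, Complex.norm_real, Real.norm_of_nonneg hC,
    Real.mul_rpow hC (norm_nonneg _)]

/-- If every `p`-convex hull containing `K`, dilated by `C`, contains `L`, then
`m_p(L) ≤ C m_p(K)`. -/
lemma isRelPCompact_and_mP_le {p C : ℝ} (hp : 1 ≤ p) (hC : 0 ≤ C) {K L : Set F}
    (hK : IsRelPCompact p K) (h : ∀ x : ℕ → F, K ⊆ pCo p x → L ⊆ pCo p ((C : ℂ) • x)) :
    IsRelPCompact p L ∧ mP p L ≤ C * mP p K := by
  have hsum (x : ℕ → F) (hx : Summable fun n => ‖x n‖ ^ p) :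
      Summable fun n => ‖((C : ℂ) • x) n‖ ^ p := by
    simpa only [norm_smul_rpow hC] using hx.mul_left (C ^ p)
  obtain ⟨x, hx, hKx⟩ := hK
  refine ⟨⟨(C : ℂ) • x, hsum x hx, h x hKx⟩, ?_⟩
  unfold mP
  rw [← smul_eq_mul, ← Real.sInf_smul_of_nonneg hC]
  refine csInf_le_csInf ⟨0, ?_⟩ (Set.Nonempty.smul_set ⟨_, x, hx, hKx, rfl⟩) ?_
  · rintro r ⟨z, -, -, rfl⟩
    have : 0 ≤ ∑' n, ‖z n‖ ^ p := tsum_nonneg fun n => by positivity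
    positivity
  · rintro r ⟨_, ⟨z, hz, hKz, rfl⟩, rfl⟩
    refine ⟨(C : ℂ) • z, hsum z hz, h z hKz, ?_⟩
    have hz0 : 0 ≤ ∑' n, ‖z n‖ ^ p := tsum_nonneg fun n => by positivity
    simp only [norm_smul_rpow hC]
    rw [tsum_mul_left, Real.mul_rpow (by positivity) hz0, ← Real.rpow_mul hC,
      mul_one_div_cancel (by linarith), Real.rpow_one, smul_eq_mul]

/-- Summing the powers `k + m - 1` of the `m`-th roots of unity picks out `k = 1`. -/
lemma IsPrimitiveRoot.sum_pow_mul_pow {ω : ℂ} {m : ℕ} (hω : IsPrimitiveRoot ω m) (hm : 2 ≤ m)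
    {k : ℕ} (hk : k ≤ m) :
    ∑ j ∈ Finset.range m, (ω ^ j) ^ (m - 1) * (ω ^ j) ^ k = if k = 1 then (m : ℂ) else 0 := by
  have hterm (j : ℕ) : (ω ^ j) ^ (m - 1) * (ω ^ j) ^ k = (ω ^ (m - 1 + k)) ^ j := by
    rw [← pow_add, ← pow_mul, ← pow_mul, mul_comm]
  simp only [hterm]
  split_ifs with h
  · subst h
    simp [Nat.sub_add_cancel (by omega : 1 ≤ m), hω.pow_eq_one]
  · have hne : ω ^ (m - 1 + k) ≠ 1 := by
      rw [Ne, hω.pow_eq_one_iff_dvd]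
      rintro ⟨d, hd⟩
      rcases Nat.lt_or_ge d 2 with hd2 | hd2
      · interval_cases d <;> omega
      · have := Nat.mul_le_mul_left m hd2
        omega
    rw [geom_sum_eq hne, ← pow_mul, mul_comm, pow_mul, hω.pow_eq_one]
    simp

/-- Discrete Cauchy formula: the derivative of `z ↦ A (x + z u, …, x + z u)` at the origin is
an average of its values over the `m`-th roots of unity times `r`. -/
lemma sum_polyEval_add_smul {m : ℕ} (hm : 2 ≤ m)
    (A : ContinuousMultilinearMap ℂ (fun _ : Fin m => E) F)
    (hsym : ∀ (v : Fin m → E) (σ : Equiv.Perm (Fin m)), A (v ∘ σ) = A v)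
    {ω : ℂ} (hω : IsPrimitiveRoot ω m) (r : ℂ) (u x : E) :
    ∑ j ∈ Finset.range m, (ω ^ j) ^ (m - 1) • polyEval A (x + (ω ^ j * r) • u) =
      ((m : ℂ) * m * r) • A fun i => if (i : ℕ) = 0 then u else x := by
  set v := A fun i => if (i : ℕ) = 0 then u else x with hv
  have hexp (z : ℂ) : polyEval A (x + z • u) =
      ∑ s : Finset (Fin m), z ^ s.card • A (s.piecewise (fun _ => u) fun _ => x) := by
    have h := A.map_add_univ (fun _ => z • u) (fun _ => x)
    rw [polyEval, add_comm x]
    refine h.trans (Finset.sum_congr rfl fun s _ => ?_)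
    have := A.toMultilinearMap.map_piecewise_smul (fun _ => z) (s.piecewise (fun _ => u) fun _ => x) s
    simp only [Finset.prod_const] at this
    rw [← ContinuousMultilinearMap.coe_coe, ← this]
    congr 1
    ext i
    by_cases hi : i ∈ s <;> simp [hi]
  have hone (s : Finset (Fin m)) (hs : s.card = 1) :
      A (s.piecewise (fun _ => u) fun _ => x) = v := by
    obtain ⟨i, rfl⟩ := Finset.card_eq_one.mp hs
    rw [hv, ← hsym (fun i => if (i : ℕ) = 0 then u else x) (Equiv.swap i ⟨0, by omega⟩)]
    congr 1
    ext j
    have : ((Equiv.swap i (⟨0, by omega⟩ : Fin m)) j : ℕ) = 0 ↔ j = i := by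
      rw [show ∀ k : Fin m, (k : ℕ) = 0 ↔ k = ⟨0, by omega⟩ from fun k => by simp [Fin.ext_iff],
        Equiv.swap_apply_eq_iff, Equiv.swap_apply_right]
    simp [Finset.piecewise, this]
  simp only [hexp, Finset.smul_sum, smul_smul]
  rw [Finset.sum_comm]
  have hterm (s : Finset (Fin m)) :
      ∑ j ∈ Finset.range m, ((ω ^ j) ^ (m - 1) * (ω ^ j * r) ^ s.card) •
        A (s.piecewise (fun _ => u) fun _ => x) = if s.card = 1 then ((m : ℂ) * r) • v else 0 := by
    have hs : s.card ≤ m := by simpa using s.card_le_univ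
    rw [← Finset.sum_smul]
    simp only [mul_pow, ← mul_assoc]
    rw [← Finset.sum_mul, hω.sum_pow_mul_pow hm hs]
    split_ifs with h
    · rw [hone s h, h, pow_one]
    · simp
  rw [Finset.sum_congr rfl fun s _ => hterm s, ← Finset.sum_filter, Finset.sum_const,
    Finset.univ_filter_card_eq, Finset.card_powersetCard]
  simp [← Nat.cast_smul_eq_nsmul ℂ, smul_smul, mul_assoc]

lemma polyEval_smul {m : ℕ} (A : ContinuousMultilinearMap ℂ (fun _ : Fin m => E) F) (c : ℂ)
    (x : E) : polyEval A (c • x) = c ^ m • polyEval A x := by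
  simpa [polyEval] using A.map_smul_univ (fun _ => c) fun _ => x

lemma one_add_inv_pow_le_exp (n : ℕ) : (1 + (n : ℝ)⁻¹) ^ n ≤ Real.exp 1 := by
  rcases eq_or_ne n 0 with rfl | hn
  · simp
  calc (1 + (n : ℝ)⁻¹) ^ n ≤ Real.exp ((n : ℝ)⁻¹) ^ n := by
        gcongr
        linarith [Real.add_one_le_exp ((n : ℝ)⁻¹)]
    _ = Real.exp 1 := by
        rw [← Real.exp_nat_mul, mul_inv_cancel₀ (by exact_mod_cast hn)]

/-- The polynomial `x ↦ A (u, x, …, x)` maps the unit ball into `e` times any `p`-convex hull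
containing the image of the unit ball under `x ↦ A (x, …, x)`. -/
lemma exists_mem_pCo_eq_exp_smul {p : ℝ} (hp : 1 ≤ p) {m : ℕ} (hm : 2 ≤ m)
    (A : ContinuousMultilinearMap ℂ (fun _ : Fin m => E) F)
    (hsym : ∀ (v : Fin m → E) (σ : Equiv.Perm (Fin m)), A (v ∘ σ) = A v)
    {z : ℕ → F} (hz : polyEval A '' closedBall 0 1 ⊆ pCo p z)
    {u x : E} (hu : ‖u‖ ≤ 1) (hx : ‖x‖ ≤ 1) :
    ∃ y ∈ pCo p z, (A fun i => if (i : ℕ) = 0 then u else x) = (Real.exp 1 : ℂ) • y := by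
  obtain ⟨n, rfl⟩ : ∃ n, m = n + 1 := ⟨m - 1, by omega⟩
  have hn : (0 : ℝ) < n := by exact_mod_cast (by omega : 0 < n)
  have hnC : (n : ℂ) ≠ 0 := by exact_mod_cast hn.ne'
  have hn1C : (n : ℂ) + 1 ≠ 0 := by exact_mod_cast n.succ_ne_zero
  have hω := Complex.isPrimitiveRoot_exp (n + 1) (by omega)
  set ω := Complex.exp (2 * Real.pi * Complex.I / ((n + 1 : ℕ) : ℂ))
  have hωn : ‖ω‖ = 1 := hω.norm'_eq_one (by omega)
  set R : ℝ := 1 + (n : ℝ)⁻¹ with hR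
  have hR0 : 0 < R := by positivity
  have hRC : (R : ℂ) ≠ 0 := by exact_mod_cast hR0.ne'
  set w : ℕ → F := fun j =>
    polyEval A ((R : ℂ)⁻¹ • (x + (ω ^ j * (n : ℂ)⁻¹) • u)) with hw
  have hwmem (j : ℕ) : w j ∈ pCo p z := by
    refine hz ⟨_, ?_, rfl⟩
    rw [mem_closedBall_zero_iff, norm_smul, norm_inv, Complex.norm_real,
      Real.norm_of_nonneg hR0.le, inv_mul_le_iff₀ hR0, mul_one, hR]
    refine (norm_add_le _ _).trans (add_le_add hx ?_)
    rw [norm_smul, norm_mul, norm_pow, hωn]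
    simpa using mul_le_of_le_one_right (inv_nonneg.2 hn.le) hu
  have hwP (j : ℕ) : polyEval A (x + (ω ^ j * (n : ℂ)⁻¹) • u) = (R : ℂ) ^ (n + 1) • w j := by
    rw [hw, ← polyEval_smul, smul_inv_smul₀ hRC]
  set c : ℂ := ((R ^ n / Real.exp 1 : ℝ) : ℂ) with hc
  have hcn : ‖c‖ ≤ 1 := by
    rw [hc, Complex.norm_real, Real.norm_of_nonneg (by positivity), div_le_one (Real.exp_pos _)]
    exact one_add_inv_pow_le_exp n
  refine ⟨∑ j ∈ Finset.range (n + 1), ((n + 1 : ℕ) : ℝ)⁻¹ • ((c * (ω ^ j) ^ n) • w j),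
    (convex_pCo hp z).sum_mem (fun _ _ => by positivity) (by simp; field_simp)
      fun j _ => smul_mem_pCo hp (hwmem j) ?_, ?_⟩
  · simpa [norm_pow, hωn] using hcn
  · have key := sum_polyEval_add_smul hm A hsym hω (n : ℂ)⁻¹ u x
    simp only [hwP, Nat.add_sub_cancel] at key
    have hcoef : ((n + 1 : ℕ) : ℂ) * ((n + 1 : ℕ) : ℂ) * (n : ℂ)⁻¹ ≠ 0 := by
      push_cast
      simp [hnC, hn1C]
    have hRn : (R : ℂ) = (n + 1) / n := by
      rw [hR]; push_cast; field_simp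
    have he : (Real.exp 1 : ℂ) ≠ 0 := by exact_mod_cast (Real.exp_pos 1).ne'
    apply smul_right_injective F hcoef
    simp only
    rw [← key, smul_smul, Finset.smul_sum]
    refine Finset.sum_congr rfl fun j _ => ?_
    rw [← Complex.coe_smul, smul_smul, smul_smul, smul_smul]
    congr 1
    rw [hc]
    push_cast
    rw [pow_succ (R : ℂ) n, show (R : ℂ) ^ n * R = R ^ n * ((n + 1) / n) by rw [← hRn]]
    rw [Complex.ofReal_exp] at he
    push_cast at he
    field_simp

/-- **(Key step of Theorem 5.1.)** Let `E`, `F` be Banach spaces, `1 ≤ p < ∞`, `m ≥ 2`,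
and let `P : E → F` be a `p`-compact `m`-homogeneous polynomial, with associated
continuous symmetric `m`-linear map `P̌`.  For `a ∈ E`, the `(m-1)`-homogeneous
polynomial `P_a(x) = P̌(a, x, …, x)` is `p`-compact and `κ_p(P_a) ≤ e ‖a‖ κ_p(P)`. -/
theorem statement16 [CompleteSpace E] [CompleteSpace F] (p : ℝ) (hp : 1 ≤ p)
    (m : ℕ) (hm : 2 ≤ m)
    (A : ContinuousMultilinearMap ℂ (fun _ : Fin m => E) F)
    (hsym : ∀ (v : Fin m → E) (σ : Equiv.Perm (Fin m)), A (v ∘ σ) = A v)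
    (hP : IsRelPCompact p (polyEval A '' closedBall 0 1)) (a : E) :
    IsRelPCompact p
      ((fun x => A fun i => if (i : ℕ) = 0 then a else x) '' closedBall 0 1) ∧
    mP p ((fun x => A fun i => if (i : ℕ) = 0 then a else x) '' closedBall 0 1) ≤
      Real.exp 1 * ‖a‖ * mP p (polyEval A '' closedBall 0 1) := by
  have hC : 0 ≤ Real.exp 1 * ‖a‖ := by positivity
  refine isRelPCompact_and_mP_le hp hC hP fun z hz => ?_
  rintro _ ⟨x, hx, rfl⟩
  obtain ⟨y, hy, hAy⟩ := exists_mem_pCo_eq_exp_smul hp hm A hsym hz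
    (u := (‖a‖⁻¹ : ℂ) • a) (x := x)
    (by simpa [norm_smul] using inv_mul_le_one) (mem_closedBall_zero_iff.1 hx)
  have ha : a = (‖a‖ : ℂ) • (‖a‖⁻¹ : ℂ) • a := by
    rcases eq_or_ne a 0 with rfl | h
    · simp
    · rw [smul_inv_smul₀ (by simpa using h)]
  have hlin (b : E) (c : ℂ) : (A fun i => if (i : ℕ) = 0 then c • b else x) =
      c • A fun i => if (i : ℕ) = 0 then b else x := by
    have hup (b : E) : (fun i : Fin m => if (i : ℕ) = 0 then b else x) =
        Function.update (fun _ => x) ⟨0, by omega⟩ b := by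
      ext i
      simp [Function.update_apply, Fin.ext_iff]
    rw [hup, hup, A.map_update_smul]
  have : (A fun i => if (i : ℕ) = 0 then a else x) = ((Real.exp 1 * ‖a‖ : ℝ) : ℂ) • y := by
    conv_lhs => rw [ha, hlin, hAy]
    rw [smul_smul]
    push_cast
    rw [mul_comm]
  simp only [this]
  exact smul_mem_pCo_smul hy _

end
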